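/- arXiv:1608.06724 — 2 statements merged into one kernel-verified Lean document; each statement's English description precedes it below -/
import Mathlib

section
/- For every k ≥ 3 there exists a sequence of non-trivial k-uniform hypergraph properties f on n vertices with s(f) = O(n^{⌈k/3⌉}). -/
open Finset

/-- The sensitivity of `f` at input `x`: the number of coordinates whose flip changes `f`. -/
def sensAt {ι : Type} [Fintype ι] [DecidableEq ι] (f : (ι → Bool) → Bool) (x : ι → Bool) : ℕ :=
  (Finset.univ.filter fun i => f (Function.update x i (!x i)) ≠ f x).card

/-- The sensitivity of `f`: the maximum of `sensAt f x` over all inputs `x`. -/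
def sensitivity {ι : Type} [Fintype ι] [DecidableEq ι] (f : (ι → Bool) → Bool) : ℕ :=
  Finset.univ.sup fun x => sensAt f x

/-- Flip the coordinates of `x` in the block `B`. -/
def flipBlock {ι : Type} [DecidableEq ι] (x : ι → Bool) (B : Finset ι) : ι → Bool :=
  fun i => if i ∈ B then !x i else x i

/-- The block sensitivity of `f` at `x`. -/
noncomputable def blockSensAt {ι : Type} [Fintype ι] [DecidableEq ι] (f : (ι → Bool) → Bool)
    (x : ι → Bool) : ℕ :=
  sSup {r | ∃ B : Fin r → Finset ι,
    (∀ i j, i ≠ j → Disjoint (B i) (B j)) ∧ ∀ j, f (flipBlock x (B j)) ≠ f x}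

/-- The block sensitivity of `f`. -/
noncomputable def blockSens {ι : Type} [Fintype ι] [DecidableEq ι] (f : (ι → Bool) → Bool) : ℕ :=
  Finset.univ.sup fun x => blockSensAt f x

/-- The support of a partial assignment `p : ι → Option Bool`. -/
def psupport {ι : Type} [Fintype ι] [DecidableEq ι] (p : ι → Option Bool) : Finset ι :=
  Finset.univ.filter fun i => p i ≠ none

/-- `x` is consistent with the partial assignment `p`. -/
def consistentWith {ι : Type} (x : ι → Bool) (p : ι → Option Bool) : Prop :=
  ∀ i b, p i = some b → x i = b

/-- `p` is a `b`-certificate for `f`. -/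
def isCertificate {ι : Type} (f : (ι → Bool) → Bool) (p : ι → Option Bool) (b : Bool) : Prop :=
  ∀ x, consistentWith x p → f x = b

/-- The certificate complexity of `f` at `x`. -/
noncomputable def certAt {ι : Type} [Fintype ι] [DecidableEq ι] (f : (ι → Bool) → Bool) (x : ι → Bool) : ℕ :=
  sInf {c | ∃ p, consistentWith x p ∧ isCertificate f p (f x) ∧ (psupport p).card = c}

/-- The certificate complexity of `f`. -/
noncomputable def certC {ι : Type} [Fintype ι] [DecidableEq ι] (f : (ι → Bool) → Bool) : ℕ :=
  Finset.univ.sup fun x => certAt f x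

/-- The `b`-sensitivity of `f`: max of `sensAt f x` over inputs `x` with `f x = b`. -/
def sensB {ι : Type} [Fintype ι] [DecidableEq ι] (b : Bool) (f : (ι → Bool) → Bool) : ℕ :=
  (Finset.univ.filter fun x => f x = b).sup fun x => sensAt f x

/-- The `b`-certificate complexity of `f`. -/
noncomputable def certB {ι : Type} [Fintype ι] [DecidableEq ι] (b : Bool) (f : (ι → Bool) → Bool) : ℕ :=
  (Finset.univ.filter fun x => f x = b).sup fun x => certAt f x

/-- The partial assignment obtained by permuting the coordinates of `p` by `σ`. -/
def permP {ι : Type} (σ : Equiv.Perm ι) (p : ι → Option Bool) : ι → Option Bool :=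
  fun i => p (σ i)

/-- Distance between partial assignments: number of coordinates on which both are set
and they disagree. -/
def pdist {ι : Type} [Fintype ι] [DecidableEq ι] (p p' : ι → Option Bool) : ℕ :=
  (Finset.univ.filter fun i =>
    (p i = some true ∧ p' i = some false) ∨ (p i = some false ∧ p' i = some true)).card

/-- Edges of a `k`-uniform hypergraph on vertex set `Fin n`: `k`-element subsets. -/
def Edge (n k : ℕ) : Type := {S : Finset (Fin n) // S.card = k}

instance (n k : ℕ) : DecidableEq (Edge n k) := by unfold Edge; infer_instance
instance (n k : ℕ) : Fintype (Edge n k) := by unfold Edge; infer_instance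

/-- The action of a vertex permutation on edges. -/
def edgeMap {n k : ℕ} (σ : Equiv.Perm (Fin n)) (e : Edge n k) : Edge n k :=
  ⟨e.1.image σ, by rw [Finset.card_image_of_injective _ σ.injective]; exact e.2⟩

/-- `f` is a `k`-uniform hypergraph property: it is invariant under vertex permutations. -/
def IsHypergraphProperty {n k : ℕ} (f : (Edge n k → Bool) → Bool) : Prop :=
  ∀ (σ : Equiv.Perm (Fin n)) (x : Edge n k → Bool), f (fun e => x (edgeMap σ e)) = f x

/-- The number of edges of a hypergraph given by its edge-indicator vector. -/
def edgeCount {n k : ℕ} (G : Edge n k → Bool) : ℕ :=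
  (Finset.univ.filter fun e => G e = true).card

/-- The degree of a vertex `v` in the hypergraph `G`. -/
def degree {n k : ℕ} (G : Edge n k → Bool) (v : Fin n) : ℕ :=
  (Finset.univ.filter fun e : Edge n k => G e = true ∧ v ∈ e.1).card

/-- Invariance of a `k`-partite `k`-uniform hypergraph property under independent
permutations of each coordinate. -/
def IsPartiteProperty {n k : ℕ} (f : ((Fin k → Fin n) → Bool) → Bool) : Prop :=
  ∀ (σ : Fin k → Equiv.Perm (Fin n)) (x : (Fin k → Fin n) → Bool),
    f (fun e => x fun i => σ i (e i)) = f x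


namespace HUB

variable {α : Type} [DecidableEq α]

def col (P Q T : Finset α) : Prop := ¬ Disjoint T P ∨ Disjoint T Q

def val (m : ℕ) (P Q T : Finset α) : Prop := (m < T.card ↔ ¬ col P Q T)

structure Valid (c : ℕ) (B P Q R : Finset α) : Prop where
  cP : P.card = c
  cQ : Q.card = c
  cR : R.card = c
  PQ : Disjoint P Q
  PR : Disjoint P R
  QR : Disjoint Q R
  BW : Disjoint B (P ∪ Q ∪ R)

lemma Valid.cardW {c : ℕ} {B P Q R : Finset α} (h : Valid c B P Q R) :
    (P ∪ Q ∪ R).card = 3 * c := by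
  rw [card_union_of_disjoint, card_union_of_disjoint h.PQ, h.cP, h.cQ, h.cR]
  · ring
  · rw [disjoint_union_left]; exact ⟨h.PR, h.QR⟩

def FewConf (m : ℕ) (B P Q R P' Q' R' a a' : Finset α) : Prop :=
  ∀ E : Finset α, E.card = 2 * m → Disjoint B E → m ≤ (E ∩ (P ∪ Q ∪ R)).card →
    m ≤ (E ∩ (P' ∪ Q' ∪ R')).card →
    ¬ (val m P Q (E ∩ (P ∪ Q ∪ R)) ↔ val m P' Q' (E ∩ (P' ∪ Q' ∪ R'))) → E = a ∨ E = a'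

lemma FewConf.symm {m : ℕ} {B P Q R P' Q' R' a a' : Finset α}
    (h : FewConf m B P Q R P' Q' R' a a') : FewConf m B P' Q' R' P Q R a a' := by
  intro E h1 h2 h3 h4 h5
  exact h E h1 h2 h4 h3 (fun h' => h5 h'.symm)

lemma three_insert {K a a' : Finset α} {z1 z2 z3 : α} (h1 : z1 ∉ K) (h2 : z2 ∉ K) (h3 : z3 ∉ K)
    (h12 : z1 ≠ z2) (h13 : z1 ≠ z3) (h23 : z2 ≠ z3)
    (e1 : insert z1 K = a ∨ insert z1 K = a') (e2 : insert z2 K = a ∨ insert z2 K = a')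
    (e3 : insert z3 K = a ∨ insert z3 K = a') : False := by
  have key : ∀ {y z : α}, y ∉ K → y ≠ z → insert y K ≠ insert z K := by
    intro y z hy hyz h
    have : y ∈ insert z K := h ▸ mem_insert_self y K
    rcases mem_insert.1 this with h | h
    · exact hyz h
    · exact hy h
  have k12 := key h1 h12
  have k13 := key h1 h13
  have k23 := key h2 h23
  rcases e1 with e1 | e1 <;> rcases e2 with e2 | e2 <;> rcases e3 with e3 | e3 <;>
    simp_all

set_option maxHeartbeats 4000000 in
lemma pair_conf {m c : ℕ} {B P Q R P' Q' R' a a' : Finset α} [Fintype α]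
    (hV : Valid c B P Q R) (hV' : Valid c B P' Q' R') (hm : 1 ≤ m) (hc : 2 * m + 3 ≤ c)
    (hn : B.card + 6 * c + m + 3 ≤ Fintype.card α)
    (hF : FewConf m B P Q R P' Q' R' a a')
    (s v : α) (F : Finset α) (hs : s ∈ P ∪ Q ∪ R) (hs' : s ∈ P' ∪ Q' ∪ R')
    (hv : v ∈ P ∪ Q ∪ R) (hv' : v ∉ P' ∪ Q' ∪ R') (hFW : F ⊆ P ∪ Q ∪ R) (hFc : F.card ≤ c + 1)
    (hsF : s ∉ F) (hvF : v ∉ F)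
    (H : ∀ M : Finset α, s ∈ M → v ∉ M → Disjoint M F → (col P Q (insert v M) ↔ col P Q M)) :
    ∃ E : Finset α, (E = a ∨ E = a') ∧ s ∈ E ∧ v ∈ E ∧ Disjoint E F ∧
      (E ∩ (P ∪ Q ∪ R)).card = m + 1 ∧ (E ∩ (P' ∪ Q' ∪ R')).card = m := by
  have cW := hV.cardW
  have cW' := hV'.cardW
  have BW := hV.BW
  have BW' := hV'.BW
  unfold FewConf at hF
  generalize P ∪ Q ∪ R = W at *
  generalize P' ∪ Q' ∪ R' = W' at *
  have hsv : s ≠ v := fun h => hv' (h ▸ hs')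
  obtain ⟨M, hM1, hM2, hMc⟩ : ∃ M : Finset α, {s} ⊆ M ∧ M ⊆ (W \ F).erase v ∧ M.card = m := by
    apply exists_subsuperset_card_eq
    · simp [hs, hsF, hsv]
    · simpa using hm
    · have h1 := le_card_sdiff F W
      have h2 := pred_card_le_card_erase (s := W \ F) (a := v)
      omega
  have hsM : s ∈ M := hM1 (mem_singleton_self s)
  have hMW : M ⊆ W := fun y hy => (mem_sdiff.1 (mem_of_mem_erase (hM2 hy))).1
  have hMF : Disjoint M F := by
    rw [disjoint_left]; intro y hy; exact (mem_sdiff.1 (mem_of_mem_erase (hM2 hy))).2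
  have hvM : v ∉ M := fun h => (ne_of_mem_erase (hM2 h)) rfl
  obtain ⟨Y, hY, hYc⟩ : ∃ Y ⊆ W' \ W, Y.card = (M \ W').card := by
    apply exists_subset_card_eq
    have h1 : (M \ W').card ≤ (W \ W').card := card_le_card (sdiff_subset_sdiff hMW (le_refl _))
    have h2 := card_sdiff_add_card_inter W W'
    have h3 := card_sdiff_add_card_inter W' W
    rw [inter_comm] at h3
    omega
  have hMs : 1 ≤ (M ∩ W').card := card_pos.2 ⟨s, mem_inter.2 ⟨hsM, hs'⟩⟩
  have hMsum := card_sdiff_add_card_inter M W'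
  have hroom : m + 3 ≤ (univ \ (B ∪ W ∪ W')).card := by
    have h1 := le_card_sdiff (B ∪ W ∪ W') univ
    have h2 := card_union_le (B ∪ W) W'
    have h3' := card_union_le B W
    rw [card_univ] at h1
    omega
  obtain ⟨Z3, hZ3, hZ3c⟩ : ∃ Z ⊆ univ \ (B ∪ W ∪ W'), Z.card = 3 :=
    exists_subset_card_eq (by omega)
  obtain ⟨Z, hZ, hZc⟩ : ∃ Z ⊆ (univ \ (B ∪ W ∪ W')) \ Z3, Z.card = (M ∩ W').card - 1 := by
    apply exists_subset_card_eq
    have h1 := le_card_sdiff Z3 (univ \ (B ∪ W ∪ W'))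
    omega
  obtain ⟨z1, z2, z3, h12, h13, h23, rfl⟩ := card_eq_three.1 hZ3c
  have hz1 := hZ3 (show z1 ∈ _ by simp)
  have hz2 := hZ3 (show z2 ∈ _ by simp)
  have hz3 := hZ3 (show z3 ∈ _ by simp)
  have hYW : ∀ y ∈ Y, y ∈ W' ∧ y ∉ W := fun y hy => mem_sdiff.1 (hY hy)
  have hZW : ∀ y ∈ Z, y ∉ B ∧ y ∉ W ∧ y ∉ W' ∧ y ≠ z1 ∧ y ≠ z2 ∧ y ≠ z3 := by
    intro y hy
    have := hZ hy
    simp only [mem_sdiff, mem_univ, mem_union, mem_insert, mem_singleton, true_and] at this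
    tauto
  simp only [mem_sdiff, mem_univ, mem_union, true_and, not_or] at hz1 hz2 hz3
  have dMY : Disjoint M Y := disjoint_left.2 fun y h1 h2 => (hYW y h2).2 (hMW h1)
  have dMYZ : Disjoint (M ∪ Y) Z := disjoint_left.2 fun y h1 h2 => by
    rcases mem_union.1 h1 with h | h
    · exact (hZW y h2).2.1 (hMW h)
    · exact (hZW y h2).2.2.1 (hYW y h).1
  obtain ⟨K, hK⟩ : ∃ K, K = M ∪ Y ∪ Z := ⟨_, rfl⟩
  have Kc : K.card + 1 = 2 * m := by
    rw [hK, card_union_of_disjoint dMYZ, card_union_of_disjoint dMY]; omega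
  have KB : Disjoint B K := by
    rw [hK, disjoint_right]
    intro y hy hB
    simp only [mem_union] at hy
    rcases hy with (h | h) | h
    · exact disjoint_left.1 BW hB (hMW h)
    · exact disjoint_left.1 BW' hB (hYW y h).1
    · exact (hZW y h).1 hB
  have KW : K ∩ W = M := by
    ext y
    have h1 := @hMW y; have h2 := hYW y; have h3 := hZW y
    simp only [hK, mem_inter, mem_union]
    tauto
  have KW' : (K ∩ W').card = m := by
    have : K ∩ W' = (M ∩ W') ∪ Y := by
      ext y
      have h2 := hYW y; have h3 := hZW y
      simp only [hK, mem_inter, mem_union]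
      tauto
    rw [this, card_union_of_disjoint (dMY.mono_left inter_subset_left)]
    omega
  have hzK : ∀ z, (z ∉ W) → z ∉ W' → z ∉ Z → z ∉ K := by
    intro z h1 h2 h3
    have h4 := @hMW z; have h5 := hYW z
    simp only [hK, mem_union]
    tauto
  have k1 : z1 ∉ K := hzK z1 hz1.1.2 hz1.2 (fun h => (hZW _ h).2.2.2.1 rfl)
  have k2 : z2 ∉ K := hzK z2 hz2.1.2 hz2.2 (fun h => (hZW _ h).2.2.2.2.1 rfl)
  have k3 : z3 ∉ K := hzK z3 hz3.1.2 hz3.2 (fun h => (hZW _ h).2.2.2.2.2 rfl)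
  have kv : v ∉ K := by
    have h5 := hYW v; have h6 := hZW v
    simp only [hK, mem_union]
    tauto
  have hagree : val m P Q M ↔ val m P' Q' (K ∩ W') := by
    by_contra hne
    have step : ∀ z, z ∉ B → z ∉ W → z ∉ W' → z ∉ K → insert z K = a ∨ insert z K = a' := by
      intro z hB hW hW' hzK
      have i1 : insert z K ∩ W = M := by rw [insert_inter_of_notMem hW, KW]
      have i2 : insert z K ∩ W' = K ∩ W' := insert_inter_of_notMem hW'
      apply hF
      · rw [card_insert_of_notMem hzK, Kc]
      · rw [disjoint_insert_right]; exact ⟨hB, KB⟩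
      · rw [i1, hMc]
      · rw [i2, KW']
      · rw [i1, i2]; exact hne
    exact three_insert k1 k2 k3 h12 h13 h23
      (step z1 hz1.1.1 hz1.1.2 hz1.2 k1) (step z2 hz2.1.1 hz2.1.2 hz2.2 k2)
      (step z3 hz3.1.1 hz3.1.2 hz3.2 k3)
  have i1 : insert v K ∩ W = insert v M := by rw [insert_inter_of_mem hv, KW]
  have i2 : insert v K ∩ W' = K ∩ W' := insert_inter_of_notMem hv'
  have c1 : (insert v M).card = m + 1 := by rw [card_insert_of_notMem hvM, hMc]
  refine ⟨insert v K, ?_, ?_, mem_insert_self _ _, ?_, ?_, ?_⟩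
  · apply hF
    · rw [card_insert_of_notMem kv, Kc]
    · rw [disjoint_insert_right]; exact ⟨disjoint_right.1 BW hv, KB⟩
    · rw [i1, c1]; omega
    · rw [i2, KW']
    · rw [i1, i2, ← hagree]
      unfold val
      rw [c1, hMc, H M hsM hvM hMF]
      simp
  · apply mem_insert_of_mem; rw [hK]; simp [hsM]
  · rw [disjoint_insert_left]
    refine ⟨hvF, ?_⟩
    rw [disjoint_left]
    intro y hy hyF
    have h1 := hFW hyF
    have h2 : y ∈ M := by rw [← KW]; exact mem_inter.2 ⟨hy, h1⟩
    exact disjoint_left.1 hMF h2 hyF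
  · rw [i1, c1]
  · rw [i2, KW']

def Good (P Q W W' F : Finset α) (s v : α) : Prop :=
  s ∈ W ∧ s ∈ W' ∧ v ∈ W ∧ v ∉ W' ∧ s ∉ F ∧ v ∉ F ∧
    ∀ M : Finset α, s ∈ M → Disjoint M F → (col P Q (insert v M) ↔ col P Q M)

lemma col_P {P Q : Finset α} {s v : α} (hs : s ∈ P) (M : Finset α) (hM : s ∈ M) :
    col P Q (insert v M) ↔ col P Q M := by
  have h1 : ¬ Disjoint M P := fun h => disjoint_left.1 h hM hs
  have h2 : ¬ Disjoint (insert v M) P := fun h => disjoint_left.1 h (mem_insert_of_mem hM) hs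
  simp [col, h1, h2]

lemma col_R {P Q : Finset α} {v : α} (hP : v ∉ P) (hQ : v ∉ Q) (M : Finset α) :
    col P Q (insert v M) ↔ col P Q M := by
  simp [col, disjoint_insert_left, hP, hQ]

lemma col_Q {P Q : Finset α} {s v : α} (hs : s ∈ Q) (hv : v ∉ P) (M : Finset α) (hM : s ∈ M) :
    col P Q (insert v M) ↔ col P Q M := by
  have h1 : ¬ Disjoint M Q := fun h => disjoint_left.1 h hM hs
  simp [col, disjoint_insert_left, hv, h1]

lemma col_RP {P Q : Finset α} {v : α} (hv : v ∈ P) (M : Finset α) (hM : Disjoint M Q) :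
    col P Q (insert v M) ↔ col P Q M := by
  have h2 : ¬ Disjoint (insert v M) P := fun h => disjoint_left.1 h (mem_insert_self _ _) hv
  simp [col, hM, h2]

lemma exists_ne_two {C : Finset α} (hC : 3 ≤ C.card) (s v : α) : ∃ t ∈ C, t ≠ s ∧ t ≠ v := by
  obtain ⟨t, ht, h⟩ := exists_mem_notMem_of_card_lt_card (s := {s, v}) (t := C)
    (lt_of_le_of_lt card_le_two (by omega))
  simp only [mem_insert, mem_singleton, not_or] at h
  exact ⟨t, ht, h.1, h.2⟩

lemma cut {P Q W W' C : Finset α} (hC : 3 ≤ C.card) (hCW : C ⊆ W)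
    (hg : ∀ s ∈ C, ∀ v ∈ C, ∀ M : Finset α, s ∈ M → (col P Q (insert v M) ↔ col P Q M))
    {s v : α} (hs : s ∈ C) (hs' : s ∈ W') (hv : v ∈ C) (hv' : v ∉ W') :
    ∃ s1 v1 s2 v2, Good P Q W W' ∅ s1 v1 ∧ Good P Q W W' ∅ s2 v2 ∧
      (s1 ≠ s2 ∨ v1 ≠ v2) := by
  have g : ∀ s ∈ C, s ∈ W' → ∀ v ∈ C, v ∉ W' → Good P Q W W' ∅ s v := fun s h1 h2 v h3 h4 =>
    ⟨hCW h1, h2, hCW h3, h4, by simp, by simp, fun M hM _ => hg s h1 v h3 M hM⟩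
  obtain ⟨t, ht, h1, h2⟩ := exists_ne_two hC s v
  by_cases htW : t ∈ W'
  · exact ⟨s, v, t, v, g s hs hs' v hv hv', g t ht htW v hv hv', Or.inl (Ne.symm h1)⟩
  · exact ⟨s, v, s, t, g s hs hs' v hv hv', g s hs hs' t ht htW, Or.inr (Ne.symm h2)⟩

lemma uncut {P Q W W' F C : Finset α} (hC : 3 ≤ C.card) (hCW : C ⊆ W) (hCW' : C ⊆ W')
    (hCF : Disjoint C F) {v : α} (hv : v ∈ W) (hv' : v ∉ W') (hvF : v ∉ F)
    (hg : ∀ s ∈ C, ∀ M : Finset α, s ∈ M → Disjoint M F → (col P Q (insert v M) ↔ col P Q M)) :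
    ∃ s1 v1 s2 v2, Good P Q W W' F s1 v1 ∧ Good P Q W W' F s2 v2 ∧
      (s1 ≠ s2 ∨ v1 ≠ v2) := by
  have g : ∀ s ∈ C, Good P Q W W' F s v := fun s h1 =>
    ⟨hCW h1, hCW' h1, hv, hv', disjoint_left.1 hCF h1, hvF, fun M hM hd => hg s h1 M hM hd⟩
  obtain ⟨t, ht, _, _⟩ := exists_ne_two hC v v
  obtain ⟨u, hu, h1, _⟩ := exists_ne_two hC t t
  exact ⟨t, v, u, v, g t ht, g u hu, Or.inl (Ne.symm h1)⟩

lemma two_good {c : ℕ} {B P Q R W' : Finset α} (hV : Valid c B P Q R) (hc : 3 ≤ c)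
    (hI : ∃ s ∈ P ∪ Q ∪ R, s ∈ W') (hJ : ∃ v ∈ P ∪ Q ∪ R, v ∉ W') :
    ∃ F ⊆ P ∪ Q ∪ R, F.card ≤ c ∧ ∃ s1 v1 s2 v2, Good P Q (P ∪ Q ∪ R) W' F s1 v1 ∧
      Good P Q (P ∪ Q ∪ R) W' F s2 v2 ∧ (s1 ≠ s2 ∨ v1 ≠ v2) := by
  have sP : P ⊆ P ∪ Q ∪ R := fun y hy => by simp [hy]
  have sQ : Q ⊆ P ∪ Q ∪ R := fun y hy => by simp [hy]
  have sR : R ⊆ P ∪ Q ∪ R := fun y hy => by simp [hy]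
  have c3P : 3 ≤ P.card := by rw [hV.cP]; exact hc
  have c3Q : 3 ≤ Q.card := by rw [hV.cQ]; exact hc
  have c3R : 3 ≤ R.card := by rw [hV.cR]; exact hc
  have vR : ∀ v ∈ R, v ∉ P ∧ v ∉ Q := fun v hv =>
    ⟨disjoint_right.1 hV.PR hv, disjoint_right.1 hV.QR hv⟩
  have vQ : ∀ v ∈ Q, v ∉ P := fun v hv => disjoint_right.1 hV.PQ hv
  by_cases kP : (∃ s ∈ P, s ∈ W') ∧ (∃ v ∈ P, v ∉ W')
  · obtain ⟨⟨s, hs, hs'⟩, v, hv, hv'⟩ := kP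
    exact ⟨∅, by simp, by simp, cut c3P sP (fun s h1 v _ M hM => col_P h1 M hM) hs hs' hv hv'⟩
  by_cases kQ : (∃ s ∈ Q, s ∈ W') ∧ (∃ v ∈ Q, v ∉ W')
  · obtain ⟨⟨s, hs, hs'⟩, v, hv, hv'⟩ := kQ
    exact ⟨∅, by simp, by simp,
      cut c3Q sQ (fun s h1 v h2 M hM => col_Q h1 (vQ v h2) M hM) hs hs' hv hv'⟩
  by_cases kR : (∃ s ∈ R, s ∈ W') ∧ (∃ v ∈ R, v ∉ W')
  · obtain ⟨⟨s, hs, hs'⟩, v, hv, hv'⟩ := kR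
    exact ⟨∅, by simp, by simp,
      cut c3R sR (fun s h1 v h2 M hM => col_R (vR v h2).1 (vR v h2).2 M) hs hs' hv hv'⟩
  by_cases hPs : ∃ s ∈ P, s ∈ W'
  · have hPW : P ⊆ W' := by
      intro v hv; by_contra h; exact kP ⟨hPs, v, hv, h⟩
    obtain ⟨v, hv, hv'⟩ := hJ
    exact ⟨∅, by simp, by simp, uncut c3P sP hPW (by simp) hv hv' (by simp)
      (fun s hs M hM _ => col_P hs M hM)⟩
  by_cases hRs : ∃ s ∈ R, s ∈ W'
  · have hRW : R ⊆ W' := by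
      intro v hv; by_contra h; exact kR ⟨hRs, v, hv, h⟩
    obtain ⟨v, hv, _⟩ := exists_ne_two c3P (hI.choose) (hI.choose)
    have hv' : v ∉ W' := fun h => hPs ⟨v, hv, h⟩
    exact ⟨Q, sQ, hV.cQ.le, uncut c3R sR hRW hV.QR.symm (sP hv) hv' (disjoint_left.1 hV.PQ hv)
      (fun s hs M hM hd => col_RP hv M hd)⟩
  have hQs : ∃ s ∈ Q, s ∈ W' := by
    obtain ⟨s, hs, hs'⟩ := hI
    simp only [mem_union] at hs
    rcases hs with (h | h) | h
    · exact absurd ⟨s, h, hs'⟩ hPs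
    · exact ⟨s, h, hs'⟩
    · exact absurd ⟨s, h, hs'⟩ hRs
  have hQW : Q ⊆ W' := by
    intro v hv; by_contra h; exact kQ ⟨hQs, v, hv, h⟩
  obtain ⟨v, hv, _⟩ := exists_ne_two c3R (hI.choose) (hI.choose)
  have hv' : v ∉ W' := fun h => hRs ⟨v, hv, h⟩
  exact ⟨∅, by simp, by simp, uncut c3Q sQ hQW (by simp) (sR hv) hv' (by simp)
      (fun s hs M hM hd => col_R (vR v hv).1 (vR v hv).2 M)⟩

lemma two_conf {m c : ℕ} {B P Q R P' Q' R' a a' : Finset α} [Fintype α]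
    (hV : Valid c B P Q R) (hV' : Valid c B P' Q' R') (hm : 1 ≤ m) (hc : 2 * m + 3 ≤ c)
    (hn : B.card + 6 * c + m + 3 ≤ Fintype.card α)
    (hF : FewConf m B P Q R P' Q' R' a a')
    (hI : ∃ s ∈ P ∪ Q ∪ R, s ∈ P' ∪ Q' ∪ R') (hJ : ∃ v ∈ P ∪ Q ∪ R, v ∉ P' ∪ Q' ∪ R') :
    ∃ E1 E2 : Finset α, E1 ≠ E2 ∧ (E1 = a ∨ E1 = a') ∧ (E2 = a ∨ E2 = a') ∧
      (E1 ∩ (P ∪ Q ∪ R)).card = m + 1 ∧ (E2 ∩ (P ∪ Q ∪ R)).card = m + 1 ∧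
      (E1 ∩ (P' ∪ Q' ∪ R')).card = m := by
  obtain ⟨F, hFW, hFc, s1, v1, s2, v2, g1, g2, hne⟩ := two_good hV (by omega) hI hJ
  obtain ⟨a1, a2, a3, a4, a5, a6, a7⟩ := g1
  obtain ⟨b1, b2, b3, b4, b5, b6, b7⟩ := g2
  have hsv1 : s1 ≠ v2 := fun h => b4 (h ▸ a2)
  have hsv2 : s2 ≠ v1 := fun h => a4 (h ▸ b2)
  obtain ⟨E2, e1, e2, e3, e4, e5, e6⟩ := pair_conf hV hV' hm hc hn hF s2 v2 F b1 b2 b3 b4 hFW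
    (by omega) b5 b6 (fun M h1 _ h2 => b7 M h1 h2)
  obtain ⟨u, hu1, hu2, huE, huW⟩ : ∃ u, u ≠ s1 ∧ u ≠ v1 ∧ u ∈ E2 ∧ u ∈ P ∪ Q ∪ R := by
    rcases hne with h | h
    · exact ⟨s2, h.symm, hsv2, e2, b1⟩
    · exact ⟨v2, hsv1.symm, h.symm, e3, b3⟩
  obtain ⟨E1, d1, d2, d3, d4, d5, d6⟩ := pair_conf hV hV' hm hc hn hF s1 v1 (insert u F)
    a1 a2 a3 a4 (insert_subset huW hFW)
    ((card_insert_le _ _).trans (by omega)) (by simp [hu1.symm, a5]) (by simp [hu2.symm, a6])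
    (fun M h1 _ h2 => a7 M h1 (h2.mono_right (subset_insert _ _)))
  refine ⟨E1, E2, ?_, d1, e1, d5, e5, d6⟩
  rintro rfl
  exact disjoint_left.1 d4 huE (mem_insert_self _ _)

set_option maxHeartbeats 4000000 in
lemma W_unique {m c : ℕ} {B P Q R P' Q' R' a a' : Finset α} [Fintype α]
    (hV : Valid c B P Q R) (hV' : Valid c B P' Q' R') (hm : 1 ≤ m) (hc : 2 * m + 3 ≤ c)
    (hn : B.card + 6 * c + m + 3 ≤ Fintype.card α)
    (hF : FewConf m B P Q R P' Q' R' a a') : P ∪ Q ∪ R = P' ∪ Q' ∪ R' := by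
  by_contra hne
  have cW := hV.cardW
  have cW' := hV'.cardW
  have hJ : ∃ v ∈ P ∪ Q ∪ R, v ∉ P' ∪ Q' ∪ R' := by
    by_contra h
    push Not at h
    exact hne (eq_of_subset_of_card_le h (by omega))
  have hJ' : ∃ v ∈ P' ∪ Q' ∪ R', v ∉ P ∪ Q ∪ R := by
    by_contra h
    push Not at h
    exact hne (eq_of_subset_of_card_le h (by omega)).symm
  by_cases hI : ∃ s ∈ P ∪ Q ∪ R, s ∈ P' ∪ Q' ∪ R'
  · obtain ⟨E1, E2, h1, h2, h3, h4, h5, h6⟩ := two_conf hV hV' hm hc hn hF hI hJ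
    obtain ⟨D1, D2, k1, k2, k3, k4, k5, k6⟩ := two_conf hV' hV hm hc hn hF.symm
      (by obtain ⟨s, h, h'⟩ := hI; exact ⟨s, h', h⟩) hJ'
    have q1 : D1 ≠ E1 := by rintro rfl; omega
    have q2 : D1 ≠ E2 := by rintro rfl; omega
    rcases h2 with h2 | h2 <;> rcases h3 with h3 | h3 <;> rcases k2 with k2 | k2 <;> simp_all
  · push Not at hI
    obtain ⟨M', hM', hMc'⟩ : ∃ M' ⊆ Q', M'.card = m :=
      exists_subset_card_eq (by rw [hV'.cQ]; omega)
    obtain ⟨Z3, hZ3, hZ3c⟩ : ∃ Z ⊆ P, Z.card = 3 :=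
      exists_subset_card_eq (by rw [hV.cP]; omega)
    obtain ⟨M, hM, hMc⟩ : ∃ M ⊆ P \ Z3, M.card = m - 1 := by
      apply exists_subset_card_eq
      have := le_card_sdiff Z3 P
      rw [hV.cP] at this
      omega
    obtain ⟨z1, z2, z3, h12, h13, h23, rfl⟩ := card_eq_three.1 hZ3c
    have hMP : ∀ y ∈ M, y ∈ P ∧ y ≠ z1 ∧ y ≠ z2 ∧ y ≠ z3 := by
      intro y hy
      have := hM hy
      simpa [mem_sdiff, not_or] using this
    have sP : ∀ y ∈ P, y ∈ P ∪ Q ∪ R := fun y hy => by simp [hy]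
    have sQ : ∀ y ∈ Q', y ∈ P' ∪ Q' ∪ R' := fun y hy => by simp [hy]
    have hMM : Disjoint M M' := disjoint_left.2 fun y h1 h2 =>
      hI y (sP y (hMP y h1).1) (sQ y (hM' h2))
    have hmM' : ∃ y, y ∈ M' := card_pos.1 (by omega)
    have step : ∀ z ∈ P, z ∉ M → z ∉ M ∪ M' ∧ (insert z (M ∪ M') = a ∨ insert z (M ∪ M') = a') := by
      intro z hz hzM
      have hzM' : z ∉ M' := fun h => hI z (sP z hz) (sQ z (hM' h))
      have hzK : z ∉ M ∪ M' := by simp [hzM, hzM']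
      refine ⟨hzK, ?_⟩
      have i1 : insert z (M ∪ M') ∩ (P ∪ Q ∪ R) = insert z M := by
        ext y
        have h1 := hMP y
        have h2 := @hM' y
        have h3 := hI y
        have h4 := sP y
        have h5 := sQ y
        have h6 : y = z → y ∈ P := by rintro rfl; exact hz
        rw [mem_inter, mem_insert, mem_union, mem_insert]
        tauto
      have i2 : insert z (M ∪ M') ∩ (P' ∪ Q' ∪ R') = M' := by
        ext y
        have h1 := hMP y
        have h2 := @hM' y
        have h3 := hI y
        have h4 := sP y
        have h5 := sQ y
        have h6 : y = z → y ∈ P := by rintro rfl; exact hz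
        rw [mem_inter, mem_insert, mem_union]
        tauto
      have c1 : (insert z M).card = m := by rw [card_insert_of_notMem hzM]; omega
      apply hF
      · rw [card_insert_of_notMem hzK, card_union_of_disjoint hMM]; omega
      · rw [disjoint_insert_right, disjoint_union_right]
        exact ⟨disjoint_right.1 hV.BW (sP z hz),
          disjoint_right.2 fun y hy => disjoint_right.1 hV.BW (sP y (hMP y hy).1),
          disjoint_right.2 fun y hy => disjoint_right.1 hV'.BW (sQ y (hM' hy))⟩
      · rw [i1, c1]
      · rw [i2, hMc']
      · rw [i1, i2]
        have hc1 : col P Q (insert z M) :=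
          Or.inl fun h => disjoint_left.1 h (mem_insert_self _ _) hz
        have hc2 : ¬ col P' Q' M' := by
          rintro (h | h)
          · exact h (hV'.PQ.symm.mono_left hM')
          · obtain ⟨y, hy⟩ := hmM'
            exact disjoint_left.1 h hy (hM' hy)
        unfold val
        rw [c1, hMc']
        simp [hc1, hc2]
    have s1 := step z1 (hZ3 (by simp)) (fun h => (hMP _ h).2.1 rfl)
    have s2 := step z2 (hZ3 (by simp)) (fun h => (hMP _ h).2.2.1 rfl)
    have s3 := step z3 (hZ3 (by simp)) (fun h => (hMP _ h).2.2.2 rfl)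
    exact three_insert s1.1 s2.1 s3.1 h12 h13 h23 s1.2 s2.2 s3.2


def Sat {n k : ℕ} (m : ℕ) (x : Edge n k → Bool) (B P Q R : Finset (Fin n)) : Prop :=
  ∀ e : Edge n k, B ⊆ e.1 → m ≤ (e.1 ∩ (P ∪ Q ∪ R)).card →
    (x e = true ↔ val m P Q (e.1 ∩ (P ∪ Q ∪ R)))

def Phi {n k : ℕ} (m c k1 : ℕ) (x : Edge n k → Bool) : Prop :=
  ∃ B P Q R : Finset (Fin n), B.card = k1 ∧ Valid c B P Q R ∧ Sat m x B P Q R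

def ErrIs {n k : ℕ} (m : ℕ) (x : Edge n k → Bool) (B P Q R : Finset (Fin n)) (e : Edge n k) :
    Prop :=
  ∀ e' : Edge n k, (B ⊆ e'.1 ∧ m ≤ (e'.1 ∩ (P ∪ Q ∪ R)).card ∧
    ¬ (x e' = true ↔ val m P Q (e'.1 ∩ (P ∪ Q ∪ R)))) ↔ e' = e

lemma val_image {β : Type} [DecidableEq β] (m : ℕ) (P Q T : Finset α) (σ : α → β)
    (hσ : Function.Injective σ) :
    val m (P.image σ) (Q.image σ) (T.image σ) ↔ val m P Q T := by
  simp only [val, col, card_image_of_injective _ hσ, disjoint_image hσ]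

lemma Phi_perm {n k m c k1 : ℕ} (σ : Equiv.Perm (Fin n)) (x : Edge n k → Bool)
    (h : Phi m c k1 (fun e => x (edgeMap σ e))) : Phi m c k1 x := by
  obtain ⟨B, P, Q, R, hB, hV, hS⟩ := h
  have hσ := σ.injective
  refine ⟨B.image σ, P.image σ, Q.image σ, R.image σ, ?_, ?_, ?_⟩
  · rw [card_image_of_injective _ hσ, hB]
  · refine ⟨?_, ?_, ?_, ?_, ?_, ?_, ?_⟩
    · rw [card_image_of_injective _ hσ, hV.cP]
    · rw [card_image_of_injective _ hσ, hV.cQ]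
    · rw [card_image_of_injective _ hσ, hV.cR]
    · rw [disjoint_image hσ]; exact hV.PQ
    · rw [disjoint_image hσ]; exact hV.PR
    · rw [disjoint_image hσ]; exact hV.QR
    · rw [← image_union, ← image_union, disjoint_image hσ]; exact hV.BW
  · intro e
    obtain ⟨e', rfl⟩ : ∃ e', edgeMap σ e' = e := by
      refine ⟨edgeMap σ⁻¹ e, ?_⟩
      apply Subtype.ext
      simp [edgeMap, image_image]
    intro h1 h2
    have h3 : (edgeMap σ e').1 = e'.1.image σ := rfl
    rw [h3, ← image_union, ← image_union, ← image_inter _ _ hσ] at h2 ⊢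
    rw [h3, image_subset_image_iff hσ] at h1
    rw [card_image_of_injective _ hσ] at h2
    rw [val_image _ _ _ _ _ hσ]
    exact hS e' h1 h2

lemma dom_card {n k m k1 w : ℕ} (hk : k1 + 2 * m = k) (B W : Finset (Fin n)) (hB : B.card = k1)
    (hW : W.card = w) (hBW : Disjoint B W) (D : Finset (Edge n k))
    (hD : ∀ e ∈ D, B ⊆ e.1 ∧ m ≤ (e.1 ∩ W).card) : D.card ≤ 2 ^ w * n ^ m := by
  have h1 : D.image (fun e => e.1) ⊆
      (W.powerset ×ˢ powersetCard m (univ : Finset (Fin n))).image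
        (fun p => B ∪ p.1 ∪ p.2) := by
    intro E hE
    obtain ⟨e, he, rfl⟩ := mem_image.1 hE
    obtain ⟨hBe, hm⟩ := hD e he
    obtain ⟨M, hM, hMc⟩ := exists_subset_card_eq hm
    have hMe : M ⊆ e.1 := hM.trans inter_subset_left
    have hMW : M ⊆ W := hM.trans inter_subset_right
    rw [mem_image]
    refine ⟨(M, e.1 \ (B ∪ M)), ?_, ?_⟩
    · rw [mem_product, mem_powerset, mem_powersetCard]
      refine ⟨hMW, subset_univ _, ?_⟩
      rw [card_sdiff_of_subset (union_subset hBe hMe),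
        card_union_of_disjoint (hBW.mono_right hMW), e.2]
      omega
    · exact union_sdiff_of_subset (union_subset hBe hMe)
  have h2 : (D.image (fun e => e.1)).card = D.card :=
    card_image_of_injective _ Subtype.val_injective
  calc D.card = _ := h2.symm
    _ ≤ _ := card_le_card h1
    _ ≤ _ := card_image_le
    _ = 2 ^ w * n.choose m := by
      rw [card_product, card_powerset, card_powersetCard, hW, card_univ, Fintype.card_fin]
    _ ≤ _ := Nat.mul_le_mul_left _ (Nat.choose_le_pow _ _)

lemma fewConf_of_err {n k m c k1 : ℕ} (hk : k1 + 2 * m = k) {x : Edge n k → Bool}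
    {B P Q R P' Q' R' : Finset (Fin n)} {e e' : Edge n k} (hB : B.card = k1)
    (hV : Valid c B P Q R) (hV' : Valid c B P' Q' R')
    (h : ErrIs m x B P Q R e) (h' : ErrIs m x B P' Q' R' e') :
    FewConf m B P Q R P' Q' R' (e.1 \ B) (e'.1 \ B) := by
  intro E hE hBE hm hm' hne
  let d : Edge n k := ⟨B ∪ E, by rw [card_union_of_disjoint hBE]; omega⟩
  have i1 : d.1 ∩ (P ∪ Q ∪ R) = E ∩ (P ∪ Q ∪ R) := by
    show (B ∪ E) ∩ _ = _
    rw [union_inter_distrib_right, disjoint_iff_inter_eq_empty.1 hV.BW, empty_union]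
  have i2 : d.1 ∩ (P' ∪ Q' ∪ R') = E ∩ (P' ∪ Q' ∪ R') := by
    show (B ∪ E) ∩ _ = _
    rw [union_inter_distrib_right, disjoint_iff_inter_eq_empty.1 hV'.BW, empty_union]
  have i3 : d.1 \ B = E := by
    show (B ∪ E) \ B = E
    rw [union_sdiff_cancel_left hBE]
  have hBd : B ⊆ d.1 := subset_union_left
  by_cases hx : (x d = true ↔ val m P Q (E ∩ (P ∪ Q ∪ R)))
  · right
    have := (h' d).1 ⟨hBd, by rw [i2]; exact hm', by
      rw [i2]; intro h2; exact hne (hx.symm.trans h2)⟩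
    rw [← this, i3]
  · left
    have := (h d).1 ⟨hBd, by rw [i1]; exact hm, by rw [i1]; exact hx⟩
    rw [← this, i3]

lemma err_card {n k m c k1 : ℕ} (hk : k1 + 2 * m = k) (hm : 1 ≤ m) (hc : 2 * m + 3 ≤ c)
    (hn : k1 + 6 * c + m + 3 ≤ n) (x : Edge n k → Bool) (B : Finset (Fin n)) (hB : B.card = k1)
    (D : Finset (Edge n k))
    (hD : ∀ e ∈ D, ∃ P Q R : Finset (Fin n), Valid c B P Q R ∧ ErrIs m x B P Q R e) :
    D.card ≤ 2 ^ (3 * c) * (2 ^ (3 * c) * 2 ^ (3 * c)) := by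
  rcases D.eq_empty_or_nonempty with rfl | ⟨e0, he0⟩
  · simp
  choose! P Q R hV hE using hD
  have hW : ∀ e ∈ D, P e ∪ Q e ∪ R e = P e0 ∪ Q e0 ∪ R e0 := by
    intro e he
    exact W_unique (hV e he) (hV e0 he0) hm hc (by rw [hB, Fintype.card_fin]; exact hn)
      (fewConf_of_err hk hB (hV e he) (hV e0 he0) (hE e he) (hE e0 he0))
  have hle : D.card ≤ ((P e0 ∪ Q e0 ∪ R e0).powerset ×ˢ ((P e0 ∪ Q e0 ∪ R e0).powerset ×ˢ
      (P e0 ∪ Q e0 ∪ R e0).powerset)).card := by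
    apply card_le_card_of_injOn (fun e => (P e, Q e, R e))
    · intro e he
      have := hW e he
      simp only [coe_product, Set.mem_prod, mem_coe, mem_powerset]
      rw [← this]
      refine ⟨fun y hy => ?_, fun y hy => ?_, fun y hy => ?_⟩ <;> simp [hy]
    · intro e he e' he' h
      simp only [Prod.mk.injEq] at h
      have h1 := hE e he
      rw [h.1, h.2.1, h.2.2] at h1
      exact ((hE e' he') e).1 ((h1 e).2 rfl)
  rwa [card_product, card_product, card_powerset, (hV e0 he0).cardW] at hle

lemma err_of_flip {n k m c k1 : ℕ} {x : Edge n k → Bool} {e : Edge n k} (b : Bool)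
    (h0 : ¬ Phi m c k1 x) {B P Q R : Finset (Fin n)} (hB : B.card = k1)
    (hV : Valid c B P Q R) (hS : Sat m (Function.update x e b) B P Q R) :
    ErrIs m x B P Q R e := by
  have hne : ∀ e' : Edge n k, (B ⊆ e'.1 ∧ m ≤ (e'.1 ∩ (P ∪ Q ∪ R)).card ∧
    ¬ (x e' = true ↔ val m P Q (e'.1 ∩ (P ∪ Q ∪ R)))) → e' = e := by
    rintro e' ⟨h1, h2, h3⟩
    by_contra hne
    have := hS e' h1 h2
    rw [Function.update_of_ne hne] at this
    exact h3 this
  intro e'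
  refine ⟨hne e', ?_⟩
  rintro rfl
  by_contra hcon
  apply h0
  refine ⟨B, P, Q, R, hB, hV, ?_⟩
  intro e'' h1 h2
  by_contra h3
  have := hne e'' ⟨h1, h2, h3⟩
  subst this
  exact hcon ⟨h1, h2, h3⟩

open Classical in
noncomputable def fn {n k : ℕ} (m c k1 : ℕ) (x : Edge n k → Bool) : Bool := decide (Phi m c k1 x)

lemma sens_le {n k m c k1 r : ℕ} (hk : k1 + 2 * m = k) (hm : 1 ≤ m) (hc : 2 * m + 3 ≤ c)
    (hn : k1 + 6 * c + m + 3 ≤ n) (hr1 : k1 ≤ r) (hr2 : m ≤ r) :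
    sensitivity (fn (n := n) (k := k) m c k1) ≤
      2 ^ (3 * c) * (2 ^ (3 * c) * 2 ^ (3 * c)) * n ^ r := by
  classical
  have hn1 : 1 ≤ n := by omega
  have hp : 1 ≤ 2 ^ (3 * c) := Nat.one_le_two_pow
  apply Finset.sup_le
  intro x _
  unfold sensAt
  by_cases hx : Phi m c k1 x
  · obtain ⟨B, P, Q, R, hB, hV, hS⟩ := id hx
    refine (dom_card (w := 3 * c) hk B (P ∪ Q ∪ R) hB hV.cardW hV.BW _ ?_).trans ?_
    · intro e he
      have he := (mem_filter.1 he).2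
      by_contra hcon
      apply he
      have : Phi m c k1 (Function.update x e (!x e)) := by
        refine ⟨B, P, Q, R, hB, hV, ?_⟩
        intro e' h1 h2
        have : e' ≠ e := by rintro rfl; exact hcon ⟨h1, h2⟩
        rw [Function.update_of_ne this]
        exact hS e' h1 h2
      simp [fn, this, hx]
    · exact Nat.mul_le_mul (Nat.le_mul_of_pos_right _ (by positivity))
        (Nat.pow_le_pow_right hn1 hr2)
  · have hsub : (univ.filter fun e => fn m c k1 (Function.update x e (!x e)) ≠ fn m c k1 x) ⊆
        (powersetCard k1 (univ : Finset (Fin n))).biUnion (fun B => univ.filter fun e =>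
          ∃ P Q R : Finset (Fin n), Valid c B P Q R ∧ ErrIs m x B P Q R e) := by
      intro e he
      have he := (mem_filter.1 he).2
      have h1 : Phi m c k1 (Function.update x e (!x e)) := by
        by_contra h
        exact he (by simp [fn, h, hx])
      obtain ⟨B, P, Q, R, hB, hV, hS⟩ := h1
      rw [mem_biUnion]
      refine ⟨B, mem_powersetCard.2 ⟨subset_univ _, hB⟩, ?_⟩
      rw [mem_filter]
      exact ⟨mem_univ _, P, Q, R, hV, err_of_flip _ hx hB hV hS⟩
    refine (card_le_card hsub).trans ((card_biUnion_le_card_mul _ _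
      (2 ^ (3 * c) * (2 ^ (3 * c) * 2 ^ (3 * c))) ?_).trans ?_)
    · intro B hB
      exact err_card hk hm hc hn x B (mem_powersetCard.1 hB).2 _
        (fun e he => (mem_filter.1 he).2)
    · rw [mul_comm, card_powersetCard, card_univ, Fintype.card_fin]
      exact Nat.mul_le_mul_left _ ((Nat.choose_le_pow _ _).trans (Nat.pow_le_pow_right hn1 hr1))

lemma nontriv {n k m c k1 : ℕ} (hk : k1 + 2 * m = k) (hm : 1 ≤ m) (hc : 2 * m + 3 ≤ c)
    (hn : k1 + 6 * c + m + 3 ≤ n) :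
    ∃ x y : Edge n k → Bool, fn m c k1 x ≠ fn m c k1 y := by
  classical
  obtain ⟨B, -, hB⟩ : ∃ B ⊆ (univ : Finset (Fin n)), B.card = k1 :=
    exists_subset_card_eq (by rw [card_univ, Fintype.card_fin]; omega)
  have room : ∀ A : Finset (Fin n), A.card + c ≤ n → ∃ P : Finset (Fin n),
      Disjoint A P ∧ P.card = c := by
    intro A hA
    obtain ⟨P, hP, hPc⟩ : ∃ P ⊆ univ \ A, P.card = c := by
      apply exists_subset_card_eq
      have := le_card_sdiff A univ
      rw [card_univ, Fintype.card_fin] at this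
      omega
    exact ⟨P, disjoint_right.2 fun y hy => (mem_sdiff.1 (hP hy)).2, hPc⟩
  obtain ⟨P, hP, hPc⟩ := room B (by omega)
  have c1 := card_union_of_disjoint hP
  obtain ⟨Q, hQ, hQc⟩ := room (B ∪ P) (by omega)
  have c2 := card_union_of_disjoint hQ
  obtain ⟨R, hR, hRc⟩ := room (B ∪ P ∪ Q) (by omega)
  simp only [disjoint_union_left] at hQ hR
  have hV : Valid c B P Q R :=
    ⟨hPc, hQc, hRc, hQ.2, hR.1.2, hR.2, by
      simp only [disjoint_union_right]; exact ⟨⟨hP, hQ.1⟩, hR.1.1⟩⟩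
  have h1 : Phi (k := k) m c k1 (fun e => decide (val m P Q (e.1 ∩ (P ∪ Q ∪ R)))) :=
    ⟨B, P, Q, R, hB, hV, fun e _ _ => by simp⟩
  have h2 : ¬ Phi (n := n) (k := k) m c k1 (fun _ => false) := by
    rintro ⟨B, P, Q, R, hB, hV, hS⟩
    obtain ⟨E, hE, hEc⟩ : ∃ E ⊆ Q, E.card = 2 * m :=
      exists_subset_card_eq (by rw [hV.cQ]; omega)
    have hEW : E ⊆ P ∪ Q ∪ R := fun y hy => by simp [hE hy]
    have hBE : Disjoint B E := hV.BW.mono_right hEW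
    have i1 : (B ∪ E) ∩ (P ∪ Q ∪ R) = E := by
      rw [union_inter_distrib_right, disjoint_iff_inter_eq_empty.1 hV.BW, empty_union,
        inter_eq_left.2 hEW]
    have := hS ⟨B ∪ E, by rw [card_union_of_disjoint hBE]; omega⟩ subset_union_left
      (by show m ≤ ((B ∪ E) ∩ _).card; rw [i1]; omega)
    have hv : val m P Q ((B ∪ E) ∩ (P ∪ Q ∪ R)) := by
      rw [i1]
      have hcol : ¬ col P Q E := by
        rintro (h | h)
        · exact h (hV.PQ.symm.mono_left hE)
        · obtain ⟨y, hy⟩ : E.Nonempty := card_pos.1 (by omega)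
          exact disjoint_left.1 h hy (hE hy)
      simp only [val, hcol, not_false_eq_true, iff_true]
      omega
    exact absurd (this.2 hv) (by simp)
  refine ⟨fun e => decide (val m P Q (e.1 ∩ (P ∪ Q ∪ R))), fun _ => false, fun h => h2 ?_⟩
  exact of_decide_eq_true (h.symm.trans (decide_eq_true h1))

end HUB

/-- for every k ≥ 3 there is a sequence of non-trivial k-uniform
hypergraph properties with sensitivity O(n^⌈k/3⌉). -/
theorem hypergraph_upper_bound (k : ℕ) (hk : 3 ≤ k) :
    ∃ C : ℝ, 0 < C ∧ ∃ N : ℕ, ∀ n ≥ N, ∃ f : (Edge n k → Bool) → Bool,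
      IsHypergraphProperty f ∧ (∃ x y, f x ≠ f y) ∧
      (sensitivity f : ℝ) ≤ C * (n : ℝ) ^ ((k + 2) / 3 : ℕ) := by
  obtain ⟨m, k1, h1, hm, hk1, hm2⟩ : ∃ m k1, k1 + 2 * m = k ∧ 1 ≤ m ∧ k1 ≤ (k + 2) / 3 ∧
      m ≤ (k + 2) / 3 := ⟨(k + 1) / 3, k - 2 * ((k + 1) / 3), by omega, by omega, by omega, by omega⟩
  refine ⟨((2 ^ (3 * (2 * m + 3)) * (2 ^ (3 * (2 * m + 3)) * 2 ^ (3 * (2 * m + 3))) : ℕ) : ℝ),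
    by positivity, k1 + 6 * (2 * m + 3) + m + 3, fun n hn => ⟨HUB.fn m (2 * m + 3) k1, ?_, ?_, ?_⟩⟩
  · intro σ x
    have : HUB.Phi m (2 * m + 3) k1 (fun e => x (edgeMap σ e)) ↔ HUB.Phi m (2 * m + 3) k1 x := by
      refine ⟨HUB.Phi_perm σ x, fun h => HUB.Phi_perm σ⁻¹ _ ?_⟩
      have hx : (fun e => x (edgeMap σ (edgeMap σ⁻¹ e))) = x := by
        funext e
        congr 1
        apply Subtype.ext
        simp [edgeMap, image_image]
      rwa [hx]
    unfold HUB.fn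
    exact decide_eq_decide.2 this
  · exact HUB.nontriv h1 hm le_rfl hn
  · exact_mod_cast HUB.sens_le h1 hm le_rfl hn hk1 hm2
end

section
/- For every k ≥ 3 there exists a sequence of non-trivial k-partite k-uniform hypergraph properties f : {0,1}^{n^k} → {0,1} with s(f) = O(n^{⌈k/3⌉}). -/
open Finset

/-- The pattern: rows `R`, columns `C` (four each); rows of `R` are one outside `C` and have at
least two ones inside; columns of `C` are zero outside `R` and have at least two zeros inside. -/
def Pat {ρ γ : Type} (x : ρ → γ → Bool) (R : Finset ρ) (C : Finset γ) : Prop :=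
  R.card = 4 ∧ C.card = 4 ∧
  (∀ r ∈ R, ∀ c, c ∉ C → x r c = true) ∧
  (∀ r ∈ R, ∃ c1 ∈ C, ∃ c2 ∈ C, c1 ≠ c2 ∧ x r c1 = true ∧ x r c2 = true) ∧
  (∀ c ∈ C, ∀ r, r ∉ R → x r c = false) ∧
  (∀ c ∈ C, ∃ r1 ∈ R, ∃ r2 ∈ R, r1 ≠ r2 ∧ x r1 c = false ∧ x r2 c = false)

lemma exists_sdiff {ρ : Type} [DecidableEq ρ] {R R' : Finset ρ} (h : R.card = 4)
    (h' : R'.card = 4) (hne : R ≠ R') : ∃ r ∈ R, r ∉ R' := by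
  by_contra! hc
  exact hne (Finset.eq_of_subset_of_card_le hc (by omega))

lemma two_points {β : Type} {P : β → Prop} {i j p q s : β} (hP : ∀ t, P t → t = i ∨ t = j)
    (hp : P p) (hq : P q) (hs : P s) (h1 : p ≠ q) (h2 : p ≠ s) (h3 : q ≠ s) : False := by
  have a := hP p hp
  have b := hP q hq
  have c := hP s hs
  grind

/-- Two inputs differing in at most two places cannot satisfy different patterns. -/
lemma pat_unique {ρ γ : Type} [DecidableEq ρ] [DecidableEq γ] {y z : ρ → γ → Bool}
    {R R' : Finset ρ} {C C' : Finset γ} (hy : Pat y R C) (hz : Pat z R' C') (i j : ρ × γ)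
    (hd : ∀ t : ρ × γ, y t.1 t.2 ≠ z t.1 t.2 → t = i ∨ t = j) : R = R' ∧ C = C' := by
  obtain ⟨hR, hC, h1, h2, h3, h4⟩ := hy
  obtain ⟨hR', hC', h1', h2', h3', h4'⟩ := hz
  by_cases eR : R = R'
  · refine ⟨eR, ?_⟩
    by_contra eC
    obtain ⟨c, hc, hc'⟩ := exists_sdiff hC hC' eC
    obtain ⟨d, hd1, hd2⟩ := exists_sdiff hC' hC (Ne.symm eC)
    subst eR
    obtain ⟨r1, m1, r2, m2, hne, e1, e2⟩ := h4 c hc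
    obtain ⟨s1, n1, s2, n2, hne', e1', e2'⟩ := h4' d hd1
    have g1 := h1' r1 m1 c hc'
    have g2 := h1' r2 m2 c hc'
    have g3 := h1 s1 n1 d hd2
    exact two_points hd (p := (r1, c)) (q := (r2, c)) (s := (s1, d)) (by simp [*]) (by simp [*])
      (by simp [*]) (by grind) (by grind) (by grind)
  · exfalso
    obtain ⟨r, hr, hr'⟩ := exists_sdiff hR hR' eR
    obtain ⟨s, hs, hs'⟩ := exists_sdiff hR' hR (Ne.symm eR)
    by_cases eC : C = C'
    · subst eC
      obtain ⟨c1, m1, c2, m2, hne, e1, e2⟩ := h2 r hr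
      obtain ⟨d1, n1, d2, n2, hne', e1', e2'⟩ := h2' s hs
      have g1 := h3' c1 m1 r hr'
      have g2 := h3' c2 m2 r hr'
      have g3 := h3 d1 n1 s hs'
      exact two_points hd (p := (r, c1)) (q := (r, c2)) (s := (s, d1)) (by simp [*]) (by simp [*])
        (by simp [*]) (by grind) (by grind) (by grind)
    · obtain ⟨c, hc, hc'⟩ := exists_sdiff hC hC' eC
      obtain ⟨d, hd1, hd2⟩ := exists_sdiff hC' hC (Ne.symm eC)
      have a1 := h1 r hr d hd2
      have a2 := h3' d hd1 r hr'
      have b1 := h3 c hc s hs'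
      have b2 := h1' s hs c hc'
      have key : ∃ q ∈ R', q ≠ s ∧ z q d = false := by
        obtain ⟨s1, n1, s2, n2, hne', e1', e2'⟩ := h4' d hd1
        by_cases s1 = s
        · exact ⟨s2, n2, by grind, e2'⟩
        · exact ⟨s1, n1, by grind, e1'⟩
      obtain ⟨q, hq, hqs, hzq⟩ := key
      by_cases hqR : q ∈ R
      · have g := h1 q hqR d hd2
        exact two_points hd (p := (r, d)) (q := (s, c)) (s := (q, d)) (by simp [*]) (by simp [*])
          (by simp [*]) (by grind) (by grind) (by grind)
      · have g := h3 c hc q hqR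
        have g' := h1' q hq c hc'
        exact two_points hd (p := (r, d)) (q := (s, c)) (s := (q, c)) (by simp [*]) (by simp [*])
          (by simp [*]) (by grind) (by grind) (by grind)

/-- Changing an entry outside `R × univ ∪ univ × C` keeps the pattern. -/
lemma pat_congr {ρ γ : Type} {y z : ρ → γ → Bool} {R : Finset ρ} {C : Finset γ} (hy : Pat y R C)
    (h : ∀ r c, r ∈ R ∨ c ∈ C → z r c = y r c) : Pat z R C := by
  obtain ⟨hR, hC, h1, h2, h3, h4⟩ := hy
  refine ⟨hR, hC, ?_, ?_, ?_, ?_⟩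
  · intro r hr c hc
    rw [h r c (.inl hr)]; exact h1 r hr c hc
  · intro r hr
    obtain ⟨c1, m1, c2, m2, hne, e1, e2⟩ := h2 r hr
    exact ⟨c1, m1, c2, m2, hne, by rw [h _ _ (.inl hr), e1], by rw [h _ _ (.inl hr), e2]⟩
  · intro c hc r hr
    rw [h r c (.inr hc)]; exact h3 c hc r hr
  · intro c hc
    obtain ⟨c1, m1, c2, m2, hne, e1, e2⟩ := h4 c hc
    exact ⟨c1, m1, c2, m2, hne, by rw [h _ _ (.inr hc), e1], by rw [h _ _ (.inr hc), e2]⟩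

/-- A pattern is preserved by permuting rows and columns. -/
lemma pat_perm {ρ γ : Type} {x : ρ → γ → Bool} {R : Finset ρ} {C : Finset γ}
    (σ : Equiv.Perm ρ) (τ : Equiv.Perm γ) (h : Pat (fun r c => x (σ r) (τ c)) R C) :
    Pat x (R.map σ.toEmbedding) (C.map τ.toEmbedding) := by
  obtain ⟨hR, hC, h1, h2, h3, h4⟩ := h
  refine ⟨by simpa using hR, by simpa using hC, ?_, ?_, ?_, ?_⟩
  · intro r hr c hc
    rw [Finset.mem_map_equiv] at hr hc
    simpa using h1 _ hr _ hc
  · intro r hr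
    rw [Finset.mem_map_equiv] at hr
    obtain ⟨c1, m1, c2, m2, hne, e1, e2⟩ := h2 _ hr
    exact ⟨τ c1, by simpa using m1, τ c2, by simpa using m2, by simpa using hne,
      by simpa using e1, by simpa using e2⟩
  · intro c hc r hr
    rw [Finset.mem_map_equiv] at hr hc
    simpa using h3 _ hc _ hr
  · intro r hr
    rw [Finset.mem_map_equiv] at hr
    obtain ⟨c1, m1, c2, m2, hne, e1, e2⟩ := h4 _ hr
    exact ⟨σ c1, by simpa using m1, σ c2, by simpa using m2, by simpa using hne,
      by simpa using e1, by simpa using e2⟩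

/-- Some matrix has the pattern. -/
lemma pat_exists {ρ γ : Type} [DecidableEq ρ] [DecidableEq γ] (u : Fin 4 ↪ ρ) (v : Fin 4 ↪ γ) :
    ∃ x R C, Pat (ρ := ρ) (γ := γ) x R C := by
  have hu := u.injective
  have hv := v.injective
  refine ⟨fun r c => decide (r ∈ Finset.univ.map u ∧ (c ∈ Finset.univ.map v →
    ((r = u 0 ∨ r = u 1) ↔ (c = v 0 ∨ c = v 1)))), Finset.univ.map u, Finset.univ.map v,
    by simp, by simp, ?_, ?_, ?_, ?_⟩
  · intro r hr c hc
    simp only [hr, hc]; simp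
  · intro r hr
    by_cases h : r = u 0 ∨ r = u 1
    · exact ⟨v 0, by simp, v 1, by simp, by simp, by simp [h, -Finset.mem_map, hr],
        by simp [h, -Finset.mem_map, hr]⟩
    · exact ⟨v 2, by simp, v 3, by simp, by simp, by simp [h, -Finset.mem_map, hr],
        by simp [h, -Finset.mem_map, hr]⟩
  · intro c hc r hr
    simp only [hr]; simp
  · intro c hc
    by_cases h : c = v 0 ∨ c = v 1
    · exact ⟨u 2, by simp, u 3, by simp, by simp, by simp [h, -Finset.mem_map, hc],
        by simp [h, -Finset.mem_map, hc]⟩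
    · exact ⟨u 0, by simp, u 1, by simp, by simp, by simp [h, -Finset.mem_map, hc],
        by simp [h, -Finset.mem_map, hc]⟩

/-- The function on three-dimensional arrays: some slice contains the pattern. -/
noncomputable def patFun {α ρ γ : Type} (x : α × ρ × γ → Bool) : Bool :=
  open Classical in decide (∃ a R C, Pat (fun r c => x (a, r, c)) R C)

lemma patFun_eq_true {α ρ γ : Type} {x : α × ρ × γ → Bool} :
    patFun x = true ↔ ∃ a R C, Pat (fun r c => x (a, r, c)) R C := by
  simp [patFun]

lemma patFun_perm {α ρ γ : Type} (π : Equiv.Perm α) (σ : Equiv.Perm ρ) (τ : Equiv.Perm γ)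
    (x : α × ρ × γ → Bool) : patFun (fun t => x (π t.1, σ t.2.1, τ t.2.2)) = patFun x := by
  rw [Bool.eq_iff_iff, patFun_eq_true, patFun_eq_true]
  constructor
  · rintro ⟨a, R, C, h⟩
    exact ⟨π a, _, _, pat_perm (x := fun r c => x (π a, r, c)) σ τ h⟩
  · rintro ⟨a, R, C, h⟩
    refine ⟨π.symm a, _, _, pat_perm (R := R) (C := C) σ.symm τ.symm ?_⟩
    simpa using h

lemma sensAt_patFun {α ρ γ : Type} [Fintype α] [Fintype ρ] [Fintype γ] [DecidableEq α]
    [DecidableEq ρ] [DecidableEq γ] (x : α × ρ × γ → Bool) :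
    sensAt patFun x ≤ 17 * (Fintype.card α + Fintype.card ρ + Fintype.card γ) := by
  unfold sensAt
  rcases hx : patFun x with _ | _
  · -- zero-inputs
    have hno : ¬ ∃ a R C, Pat (fun r c => x (a, r, c)) R C := by
      rw [← patFun_eq_true, hx]; simp
    set S := Finset.univ.filter fun i => patFun (Function.update x i (!x i)) ≠ false with hS
    have hmem : ∀ i ∈ S, ∃ R C,
        Pat (fun r c => Function.update x i (!x i) (i.1, r, c)) R C := by
      intro i hi
      have hi' : patFun (Function.update x i (!x i)) = true := by simpa [hS] using hi
      obtain ⟨a, R, C, h⟩ := patFun_eq_true.1 hi'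
      by_cases ha : a = i.1
      · subst ha; exact ⟨R, C, h⟩
      · exfalso
        refine hno ⟨a, R, C, pat_congr h ?_⟩
        intro r c _
        rw [Function.update_of_ne]
        rintro rfl
        exact ha rfl
    have hfib : ∀ a : α, (S.filter fun i => i.1 = a).card ≤ 17 := by
      intro a
      rcases (S.filter fun i => i.1 = a).eq_empty_or_nonempty with he | ⟨i0, hi0⟩
      · simp [he]
      obtain ⟨hi0S, hi0a⟩ := Finset.mem_filter.1 hi0
      obtain ⟨R, C, h0⟩ := hmem i0 hi0S
      have hsub : (S.filter fun i => i.1 = a) ⊆ insert i0 ({a} ×ˢ (R ×ˢ C)) := by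
        intro j hj
        obtain ⟨hjS, hja⟩ := Finset.mem_filter.1 hj
        obtain ⟨R', C', h1⟩ := hmem j hjS
        obtain ⟨a0, i1, i2⟩ := i0
        obtain ⟨a1, j1, j2⟩ := j
        simp only at hi0a hja
        subst hi0a
        subst hja
        obtain ⟨rfl, rfl⟩ := pat_unique h0 h1 (i1, i2) (j1, j2) (by
          intro t ht
          by_contra! hc
          apply ht
          obtain ⟨t1, t2⟩ := t
          rw [Function.update_of_ne, Function.update_of_ne]
          · intro hh; apply hc.2; simpa using hh
          · intro hh; apply hc.1; simpa using hh)
        by_cases heq : ((a1, j1, j2) : α × ρ × γ) = (a1, i1, i2)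
        · rw [heq]; simp
        have e1 : Function.update x (a1, i1, i2) (!x (a1, i1, i2)) (a1, j1, j2)
            = x (a1, j1, j2) := Function.update_of_ne heq _ _
        have e2 : Function.update x (a1, j1, j2) (!x (a1, j1, j2)) (a1, j1, j2)
            = !x (a1, j1, j2) := Function.update_self _ _ _
        rw [Finset.mem_insert]
        right
        simp only [Finset.mem_product, Finset.mem_singleton, true_and]
        by_contra hout
        obtain ⟨-, -, p1, -, p3, -⟩ := h0
        have hpat := h1
        obtain ⟨-, -, q1, -, q3, -⟩ := h1
        by_cases hj1 : j1 ∈ R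
        · have hj2 : j2 ∉ C := fun h => hout ⟨hj1, h⟩
          have w1 := p1 _ hj1 _ hj2
          have w2 := q1 _ hj1 _ hj2
          simp only [e1, e2] at w1 w2
          simp [w1] at w2
        · by_cases hj2 : j2 ∈ C
          · have w1 := p3 _ hj2 _ hj1
            have w2 := q3 _ hj2 _ hj1
            simp only [e1, e2] at w1 w2
            simp [w1] at w2
          · refine hno ⟨a1, R, C, pat_congr hpat ?_⟩
            intro r c hrc
            rw [Function.update_of_ne]
            rintro hh
            simp only [Prod.mk.injEq, true_and] at hh
            obtain ⟨rfl, rfl⟩ := hh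
            tauto
      calc _ ≤ _ := Finset.card_le_card hsub
        _ ≤ _ := Finset.card_insert_le _ _
        _ = 17 := by simp [Finset.card_product, h0.1, h0.2.1]
    have : S.card ≤ ∑ a : α, 17 := by
      rw [Finset.card_eq_sum_card_fiberwise (f := fun i => i.1) (t := Finset.univ) (by simp)]
      exact Finset.sum_le_sum fun a _ => hfib a
    simp at this
    omega
  · -- one-inputs
    obtain ⟨a, R, C, h⟩ := patFun_eq_true.1 hx
    have hsub : (Finset.univ.filter fun i => patFun (Function.update x i (!x i)) ≠ true) ⊆
        ({a} ×ˢ (R ×ˢ Finset.univ)) ∪ ({a} ×ˢ (Finset.univ ×ˢ C)) := by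
      intro j hj
      have hj' := (Finset.mem_filter.1 hj).2
      by_contra hc
      apply hj'
      refine patFun_eq_true.2 ⟨a, R, C, pat_congr h ?_⟩
      intro r c hrc
      rw [Function.update_of_ne]
      rintro rfl
      simp at hc
      tauto
    have h1 := (Finset.card_le_card hsub).trans (Finset.card_union_le _ _)
    simp [Finset.card_product, h.1, h.2.1] at h1
    simp only [ne_eq, Bool.not_eq_true] at h1 ⊢
    omega

/-- Splitting the coordinates into three groups. -/
def splitE {k a b : ℕ} (n : ℕ) (s : Fin k ≃ Fin a ⊕ (Fin b ⊕ Fin b)) :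
    (Fin k → Fin n) ≃ (Fin a → Fin n) × (Fin b → Fin n) × (Fin b → Fin n) where
  toFun t := (fun i => t (s.symm (.inl i)), fun i => t (s.symm (.inr (.inl i))),
    fun i => t (s.symm (.inr (.inr i))))
  invFun p := fun i => Sum.elim p.1 (Sum.elim p.2.1 p.2.2) (s i)
  left_inv t := by
    funext i
    obtain ⟨j, rfl⟩ := s.symm.surjective i
    rcases j with j | j | j <;> simp
  right_inv p := by
    simp

lemma arith (k : ℕ) (hk : 3 ≤ k) :
    ∃ a b, a + (b + b) = k ∧ 1 ≤ b ∧ a ≤ (k + 2) / 3 ∧ b ≤ (k + 2) / 3 := by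
  refine ⟨k - 2 * ((k + 1) / 3), (k + 1) / 3, ?_, ?_, ?_, ?_⟩ <;> omega

/-- for every k ≥ 3 there is a sequence of non-trivial k-partite
k-uniform hypergraph properties with sensitivity O(n^⌈k/3⌉). -/
theorem partite_upper_bound (k : ℕ) (hk : 3 ≤ k) :
    ∃ C : ℝ, 0 < C ∧ ∃ N : ℕ, ∀ n ≥ N, ∃ f : ((Fin k → Fin n) → Bool) → Bool,
      IsPartiteProperty f ∧ (∃ x y, f x ≠ f y) ∧
      (sensitivity f : ℝ) ≤ C * (n : ℝ) ^ ((k + 2) / 3 : ℕ) := by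
  obtain ⟨a, b, hab, hb, ha', hb'⟩ := arith k hk
  refine ⟨51, by norm_num, 4, fun n hn => ?_⟩
  have s : Fin k ≃ Fin a ⊕ (Fin b ⊕ Fin b) := Fintype.equivOfCardEq (by simp [hab])
  let e := splitE n s
  refine ⟨fun x => patFun (fun t => x (e.symm t)), ?_, ?_, ?_⟩
  · intro σ x
    beta_reduce
    rw [← patFun_perm (Equiv.piCongrRight fun i => σ (s.symm (.inl i)))
      (Equiv.piCongrRight fun i => σ (s.symm (.inr (.inl i))))
      (Equiv.piCongrRight fun i => σ (s.symm (.inr (.inr i)))) (fun t => x (e.symm t))]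
    congr 1
    funext t
    congr 1
    apply e.injective
    rw [Equiv.apply_symm_apply]
    simp [e, splitE, Equiv.piCongrRight]
    exact ⟨rfl, rfl, rfl⟩
  · let w : Fin 4 ↪ (Fin b → Fin n) :=
      ⟨fun i _ => Fin.castLE hn i, fun i j h => by
        have := congrFun h ⟨0, hb⟩
        simpa using this⟩
    obtain ⟨x, R, C, h⟩ := pat_exists w w
    refine ⟨fun t => x (e t).2.1 (e t).2.2, fun _ => true, ?_⟩
    have h1 : patFun (fun t => (fun t => x (e t).2.1 (e t).2.2) (e.symm t)) = true :=
      patFun_eq_true.2 ⟨fun _ => ⟨0, by omega⟩, R, C, by simpa using h⟩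
    have h2 : ¬ patFun (α := Fin a → Fin n) (ρ := Fin b → Fin n) (γ := Fin b → Fin n)
        (fun _ => true) = true := by
      rw [patFun_eq_true]
      rintro ⟨_, R, C, -, hC, -, -, -, h4⟩
      obtain ⟨c, hc⟩ := Finset.card_pos.1 (by omega : 0 < C.card)
      obtain ⟨_, _, _, _, _, h, _⟩ := h4 c hc
      simp at h
    intro hh
    exact h2 (hh.symm.trans h1)
  · have hs : sensitivity (fun x : (Fin k → Fin n) → Bool => patFun (fun t => x (e.symm t))) ≤
        17 * (n ^ a + n ^ b + n ^ b) := by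
      unfold sensitivity
      refine Finset.sup_le fun x _ => ?_
      have h := sensAt_patFun (fun t => x (e.symm t))
      simp only [Fintype.card_pi, Finset.prod_const, Finset.card_univ, Fintype.card_fin] at h
      refine le_trans ?_ h
      unfold sensAt
      refine Finset.card_le_card_of_injOn e ?_ e.injective.injOn
      intro i hi
      simp only [Finset.coe_filter, Finset.mem_univ, true_and, Set.mem_ofPred_eq] at hi ⊢
      convert hi using 3 with t
      by_cases ht : t = e i
      · subst ht; simp
      · rw [Function.update_of_ne ht, Function.update_of_ne]
        rintro rfl
        simp at ht
    have h1 : n ^ a ≤ n ^ ((k + 2) / 3) := Nat.pow_le_pow_right (by omega) ha'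
    have h2 : n ^ b ≤ n ^ ((k + 2) / 3) := Nat.pow_le_pow_right (by omega) hb'
    have h3 : sensitivity (fun x : (Fin k → Fin n) → Bool => patFun (fun t => x (e.symm t))) ≤
        51 * n ^ ((k + 2) / 3) := by omega
    exact_mod_cast h3
end
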